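/- arXiv:0912.5097 — 5 statements merged into one kernel-verified Lean document; each statement's English description precedes it below -/
import Mathlib

section
/- Let x₀ > 0 and y₀ > 0, let a ≥ 0, b ≥ 0 and J ≥ 0 be constants, and let f, g : [0, x₀] × [0, y₀] → ℝ be continuous nonnegative functions satisfying, for every (x, y) ∈ [0, x₀] × [0, y₀], the inequality f(x,y) + g(x,y) ≤ J + a·∫₀ˣ f(x', y) dx' + b·∫₀ʸ g(x, y') dy'. Then for every (x, y) ∈ [0, x₀] × [0, y₀] one has f(x, y) + g(x, y) ≤ 2·J·exp(2·(a·x + b·y)); in particular, both f(x,y) and g(x,y) are bounded by 2·J·exp(2·(a·x + b·y)). -/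
open MeasureTheory intervalIntegral Set

lemma gronwall_aux (a c M x : ℝ) (ha : 0 ≤ a) (hx : 0 ≤ x) (u : ℝ → ℝ)
    (hu : ContinuousOn u (Set.Icc 0 x))
    (hb : ∀ t ∈ Set.Icc (0:ℝ) x, u t ≤ M * Real.exp (2 * (a * t + c))) :
    a * (∫ t in (0:ℝ)..x, u t) ≤
      M / 2 * (Real.exp (2 * (a * x + c)) - Real.exp (2 * c)) := by
  have h1 : (∫ t in (0:ℝ)..x, a * (M * Real.exp (2 * (a * t + c)))) =
      M / 2 * Real.exp (2 * (a * x + c)) - M / 2 * Real.exp (2 * (a * 0 + c)) := by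
    apply intervalIntegral.integral_eq_sub_of_hasDerivAt
      (f := fun t => M / 2 * Real.exp (2 * (a * t + c)))
    · intro t _
      have h2 : HasDerivAt (fun t : ℝ => 2 * (a * t + c)) (2 * (a * 1)) t :=
        (((hasDerivAt_id t).const_mul a).add_const c).const_mul 2
      refine (h2.exp.const_mul (M / 2)).congr_deriv ?_
      ring
    · apply Continuous.intervalIntegrable
      fun_prop
  have h3 : (∫ t in (0:ℝ)..x, a * u t) ≤
      ∫ t in (0:ℝ)..x, a * (M * Real.exp (2 * (a * t + c))) := by
    apply intervalIntegral.integral_mono_on hx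
    · apply ContinuousOn.intervalIntegrable
      rw [Set.uIcc_of_le hx]
      exact continuousOn_const.mul hu
    · apply Continuous.intervalIntegrable
      fun_prop
    · intro t ht
      exact mul_le_mul_of_nonneg_left (hb t ht) ha
  rw [intervalIntegral.integral_const_mul, h1] at h3
  have h4 : 2 * (a * 0 + c) = 2 * c := by ring
  rw [h4] at h3
  linarith

/-- Two-variable Gronwall inequality for a pair of nonnegative continuous functions
coupled through integrals in the two coordinate directions. -/
theorem two_variable_gronwall
    (x₀ y₀ a b J : ℝ) (hx₀ : 0 < x₀) (hy₀ : 0 < y₀)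
    (ha : 0 ≤ a) (hb : 0 ≤ b) (hJ : 0 ≤ J)
    (f g : ℝ → ℝ → ℝ)
    (hf_cont : ContinuousOn (fun p : ℝ × ℝ => f p.1 p.2) (Set.Icc 0 x₀ ×ˢ Set.Icc 0 y₀))
    (hg_cont : ContinuousOn (fun p : ℝ × ℝ => g p.1 p.2) (Set.Icc 0 x₀ ×ˢ Set.Icc 0 y₀))
    (hf_nonneg : ∀ x ∈ Set.Icc (0:ℝ) x₀, ∀ y ∈ Set.Icc (0:ℝ) y₀, 0 ≤ f x y)
    (hg_nonneg : ∀ x ∈ Set.Icc (0:ℝ) x₀, ∀ y ∈ Set.Icc (0:ℝ) y₀, 0 ≤ g x y)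
    (hineq : ∀ x ∈ Set.Icc (0:ℝ) x₀, ∀ y ∈ Set.Icc (0:ℝ) y₀,
      f x y + g x y ≤
        J + a * (∫ x' in (0:ℝ)..x, f x' y) + b * (∫ y' in (0:ℝ)..y, g x y')) :
    ∀ x ∈ Set.Icc (0:ℝ) x₀, ∀ y ∈ Set.Icc (0:ℝ) y₀,
      f x y + g x y ≤ 2 * J * Real.exp (2 * (a * x + b * y)) ∧
      f x y ≤ 2 * J * Real.exp (2 * (a * x + b * y)) ∧
      g x y ≤ 2 * J * Real.exp (2 * (a * x + b * y)) := by
  obtain ⟨p, hp, hmax⟩ := (isCompact_Icc.prod isCompact_Icc).exists_isMaxOn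
    (s := Set.Icc 0 x₀ ×ˢ Set.Icc 0 y₀)
    (f := fun p : ℝ × ℝ => (f p.1 p.2 + g p.1 p.2) * Real.exp (-(2 * (a * p.1 + b * p.2))))
    ⟨(0, 0), ⟨⟨le_refl _, hx₀.le⟩, ⟨le_refl _, hy₀.le⟩⟩⟩
    ((hf_cont.add hg_cont).mul (Continuous.continuousOn (by fun_prop)))
  obtain ⟨p1, p2⟩ := p
  obtain ⟨hp1, hp2⟩ := hp
  simp only at hp1 hp2
  obtain ⟨M, hM⟩ : ∃ M, M =
    (f p1 p2 + g p1 p2) * Real.exp (-(2 * (a * p1 + b * p2))) := ⟨_, rfl⟩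
  have key : ∀ x ∈ Set.Icc (0:ℝ) x₀, ∀ y ∈ Set.Icc (0:ℝ) y₀,
      f x y + g x y ≤ M * Real.exp (2 * (a * x + b * y)) := by
    intro x hx y hy
    have h : (f x y + g x y) * Real.exp (-(2 * (a * x + b * y))) ≤ M := by
      rw [hM]
      exact hmax (show ((x, y) : ℝ × ℝ) ∈ _ from ⟨hx, hy⟩)
    rw [Real.exp_neg, ← div_eq_mul_inv, div_le_iff₀ (Real.exp_pos _)] at h
    exact h
  have hMe : f p1 p2 + g p1 p2 = M * Real.exp (2 * (a * p1 + b * p2)) := by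
    rw [hM, mul_assoc, ← Real.exp_add]
    simp
  have hsub1 : Set.Icc 0 p1 ⊆ Set.Icc 0 x₀ := Set.Icc_subset_Icc_right hp1.2
  have hsub2 : Set.Icc 0 p2 ⊆ Set.Icc 0 y₀ := Set.Icc_subset_Icc_right hp2.2
  have A := gronwall_aux a (b * p2) M p1 ha hp1.1 (fun t => f t p2)
    (hf_cont.comp (f := fun t : ℝ => (t, p2)) (Continuous.continuousOn (by fun_prop))
      (fun t ht => ⟨hsub1 ht, hp2⟩))
    (fun t ht => by
      have := key t (hsub1 ht) p2 hp2
      have := hg_nonneg t (hsub1 ht) p2 hp2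
      linarith)
  have B := gronwall_aux b (a * p1) M p2 hb hp2.1 (fun t => g p1 t)
    (hg_cont.comp (f := fun t : ℝ => (p1, t)) (Continuous.continuousOn (by fun_prop))
      (fun t ht => ⟨hp1, hsub2 ht⟩))
    (fun t ht => by
      have := key p1 hp1 t (hsub2 ht)
      have := hf_nonneg p1 hp1 t (hsub2 ht)
      rw [add_comm (b * t)]
      linarith)
  rw [add_comm (b * p2) (a * p1)] at B
  have hI := hineq p1 hp1 p2 hp2
  have e1 : 1 ≤ Real.exp (2 * (a * p1)) :=
    Real.one_le_exp (mul_nonneg (by norm_num) (mul_nonneg ha hp1.1))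
  have e2 : 1 ≤ Real.exp (2 * (b * p2)) :=
    Real.one_le_exp (mul_nonneg (by norm_num) (mul_nonneg hb hp2.1))
  have hMJ : M ≤ 2 * J := by
    by_cases h0 : M ≤ 0
    · linarith
    · nlinarith
  intro x hx y hy
  have h1 := key x hx y hy
  have h2 := mul_le_mul_of_nonneg_right hMJ (Real.exp_pos (2 * (a * x + b * y))).le
  have h3 := hf_nonneg x hx y hy
  have h4 := hg_nonneg x hx y hy
  exact ⟨by linarith, by linarith, by linarith⟩
end

section
/- Let T > 0 and A ≥ 0. Let y : [0, T] → ℝ be continuous and nonnegative, and let g : [0, T] → ℝ be Lebesgue-integrable and nonnegative. Assume that for every t ∈ [0, T] one has y(t)² ≤ A² + ∫₀ᵗ g(s)·y(s) ds. Then for every t ∈ [0, T], y(t) ≤ A + ∫₀ᵗ g(s) ds. -/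
open MeasureTheory intervalIntegral Set

/-- Quadratic (Bihari-type) Gronwall inequality: if `y(t)² ≤ A² + ∫₀ᵗ g·y`,
then `y(t) ≤ A + ∫₀ᵗ g`. -/
theorem quadratic_gronwall
    (T A : ℝ) (hT : 0 < T) (hA : 0 ≤ A)
    (y g : ℝ → ℝ)
    (hy_cont : ContinuousOn y (Set.Icc 0 T))
    (hy_nonneg : ∀ t ∈ Set.Icc (0:ℝ) T, 0 ≤ y t)
    (hg_int : MeasureTheory.IntegrableOn g (Set.Icc 0 T))
    (hg_nonneg : ∀ s ∈ Set.Icc (0:ℝ) T, 0 ≤ g s)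
    (hineq : ∀ t ∈ Set.Icc (0:ℝ) T, (y t) ^ 2 ≤ A ^ 2 + ∫ s in (0:ℝ)..t, g s * y s) :
    ∀ t ∈ Set.Icc (0:ℝ) T, y t ≤ A + ∫ s in (0:ℝ)..t, g s := by
  intro t ht
  have hsub : Set.Icc 0 t ⊆ Set.Icc 0 T := Set.Icc_subset_Icc_right ht.2
  obtain ⟨m, hm, hmax⟩ := isCompact_Icc.exists_isMaxOn
    (Set.nonempty_Icc.2 ht.1) (hy_cont.mono hsub)
  have hmT := hsub hm
  have hgt : IntervalIntegrable g volume 0 t :=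
    (intervalIntegrable_iff_integrableOn_Icc_of_le ht.1).2 (hg_int.mono_set hsub)
  have hmsub : Set.Icc 0 m ⊆ Set.Icc 0 t := Set.Icc_subset_Icc_right hm.2
  have hgm : IntervalIntegrable g volume 0 m :=
    (intervalIntegrable_iff_integrableOn_Icc_of_le hm.1).2
      (hg_int.mono_set (hmsub.trans hsub))
  have hgym : IntervalIntegrable (fun s => g s * y s) volume 0 m := by
    apply hgm.mul_continuousOn
    rw [Set.uIcc_of_le hm.1]
    exact hy_cont.mono (hmsub.trans hsub)
  have h1 : ∫ s in (0:ℝ)..m, g s * y s ≤ (∫ s in (0:ℝ)..m, g s) * y m := by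
    rw [← intervalIntegral.integral_mul_const]
    apply intervalIntegral.integral_mono_on hm.1 hgym (hgm.mul_const _)
    intro s hs
    exact mul_le_mul_of_nonneg_left (hmax (hmsub hs)) (hg_nonneg s (hsub (hmsub hs)))
  have hmt : IntervalIntegrable g volume m t := hgm.symm.trans hgt
  have h2 : (0:ℝ) ≤ ∫ s in m..t, g s :=
    intervalIntegral.integral_nonneg hm.2
      (fun s hs => hg_nonneg s ⟨hm.1.trans hs.1, hs.2.trans ht.2⟩)
  have h3 : (0:ℝ) ≤ ∫ s in (0:ℝ)..m, g s :=
    intervalIntegral.integral_nonneg hm.1 (fun s hs => hg_nonneg s (hsub (hmsub hs)))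
  have h4 := intervalIntegral.integral_add_adjacent_intervals hgm hmt
  have h5 := hineq m hmT
  have h6 : y t ≤ y m := hmax (Set.right_mem_Icc.2 ht.1)
  by_contra hcon
  push Not at hcon
  have h7 : A < y m - ∫ s in (0:ℝ)..m, g s := by linarith
  have h8 : A < y m := by linarith
  nlinarith [mul_pos (sub_pos.2 h7) (sub_pos.2 h8), mul_nonneg hA (sub_pos.2 h7).le,
    mul_nonneg hA (sub_pos.2 h8).le]
end

section
/- Let T > 0, A ≥ 0 and K ≥ 0. Let y : [0, T] → ℝ be continuous and nonnegative, and let g : [0, T] → ℝ be Lebesgue-integrable and nonnegative. Assume that for every t ∈ [0, T] one has y(t)² ≤ A² + ∫₀ᵗ ( g(s)·y(s) + K·y(s)² ) ds. Then for every t ∈ [0, T], y(t) ≤ exp(K·t)·( A + ∫₀ᵗ g(s) ds ). -/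
open MeasureTheory intervalIntegral Set

/-- Quadratic Gronwall inequality with an additional quadratic correction term:
if `y(t)² ≤ A² + ∫₀ᵗ (g·y + K·y²)`, then `y(t) ≤ exp(K·t)·(A + ∫₀ᵗ g)`. -/
theorem quadratic_gronwall_with_correction
    (T A K : ℝ) (hT : 0 < T) (hA : 0 ≤ A) (hK : 0 ≤ K)
    (y g : ℝ → ℝ)
    (hy_cont : ContinuousOn y (Set.Icc 0 T))
    (hy_nonneg : ∀ t ∈ Set.Icc (0:ℝ) T, 0 ≤ y t)
    (hg_int : MeasureTheory.IntegrableOn g (Set.Icc 0 T))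
    (hg_nonneg : ∀ s ∈ Set.Icc (0:ℝ) T, 0 ≤ g s)
    (hineq : ∀ t ∈ Set.Icc (0:ℝ) T,
      (y t) ^ 2 ≤ A ^ 2 + ∫ s in (0:ℝ)..t, (g s * y s + K * (y s) ^ 2)) :
    ∀ t ∈ Set.Icc (0:ℝ) T,
      y t ≤ Real.exp (K * t) * (A + ∫ s in (0:ℝ)..t, g s) := by
  intro t ht
  suffices H : ∀ ε > 0, ∀ t ∈ Set.Icc (0:ℝ) T,
      y t < Real.exp (K * t) * (A + ε + ∫ s in (0:ℝ)..t, g s) by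
    refine le_of_forall_pos_le_add fun δ hδ => ?_
    have he := Real.exp_pos (K * t)
    have := H (δ / Real.exp (K * t)) (by positivity) t ht
    have h2 : Real.exp (K * t) * (δ / Real.exp (K * t)) = δ := by field_simp
    linarith [mul_add (Real.exp (K * t)) (A + ∫ s in (0:ℝ)..t, g s) (δ / Real.exp (K * t)),
      show Real.exp (K * t) * (A + δ / Real.exp (K * t) + ∫ s in (0:ℝ)..t, g s)
        = Real.exp (K * t) * ((A + ∫ s in (0:ℝ)..t, g s) + δ / Real.exp (K * t)) by ring]
  clear ht t
  intro ε hε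
  set w : ℝ → ℝ := fun t => Real.exp (K * t) * (A + ε + ∫ s in (0:ℝ)..t, g s) with hw
  have hgi : IntervalIntegrable g volume 0 T := by
    apply IntegrableOn.intervalIntegrable
    rwa [uIcc_of_le hT.le]
  have hacE : AbsolutelyContinuousOnInterval (fun t => Real.exp (K * t)) 0 T :=
    ContDiffOn.absolutelyContinuousOnInterval (by fun_prop)
  have hacC : AbsolutelyContinuousOnInterval (fun _ : ℝ => A + ε) 0 T :=
    ContDiffOn.absolutelyContinuousOnInterval (by fun_prop)
  have hacG : AbsolutelyContinuousOnInterval (fun t => ∫ s in (0:ℝ)..t, g s) 0 T :=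
    hgi.absolutelyContinuousOnInterval_intervalIntegral (by simp)
  have hacw : AbsolutelyContinuousOnInterval w 0 T := hacE.fun_mul (hacC.fun_add hacG)
  have hwc : ContinuousOn w (Icc 0 T) := by
    have := hacw.continuousOn
    rwa [uIcc_of_le hT.le] at this
  have hwpos : ∀ s ∈ Icc (0:ℝ) T, 0 < w s := by
    intro s hs
    have : 0 ≤ ∫ u in (0:ℝ)..s, g u :=
      intervalIntegral.integral_nonneg hs.1 fun u hu => hg_nonneg u ⟨hu.1, hu.2.trans hs.2⟩
    simp only [hw]
    positivity
  by_contra! hcon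
  obtain ⟨t₁, ht₁, hyt₁⟩ := hcon
  have hcpt : IsCompact {t | t ∈ Icc (0:ℝ) T ∧ w t ≤ y t} :=
    isCompact_Icc.of_isClosed_subset (isClosed_Icc.isClosed_le hwc hy_cont) fun _ h => h.1
  obtain ⟨t₀, ⟨ht₀, hyt₀⟩, hmin⟩ := hcpt.exists_isLeast ⟨t₁, ht₁, hyt₁⟩
  have hlt : ∀ s, 0 ≤ s → s < t₀ → y s < w s := by
    intro s h0 hs
    by_contra! h
    exact absurd (hmin ⟨⟨h0, hs.le.trans ht₀.2⟩, h⟩) (not_le.2 hs)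
  have hsub : uIcc 0 t₀ ⊆ uIcc 0 T := by
    rw [uIcc_of_le ht₀.1, uIcc_of_le hT.le]
    exact Icc_subset_Icc_right ht₀.2
  have hac2 : AbsolutelyContinuousOnInterval (fun t => w t * w t) 0 t₀ :=
    (hacw.fun_mul hacw).mono hsub
  have hyc : ContinuousOn y (uIcc 0 t₀) := by
    rw [uIcc_of_le ht₀.1]
    exact hy_cont.mono (Icc_subset_Icc_right ht₀.2)
  have hint : IntervalIntegrable (fun s => g s * y s + K * (y s) ^ 2) volume 0 t₀ :=
    ((hgi.mono_set hsub).mul_continuousOn hyc).add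
      (ContinuousOn.intervalIntegrable (by fun_prop))
  have hmono : ∫ s in (0:ℝ)..t₀, (g s * y s + K * (y s) ^ 2)
      ≤ ∫ s in (0:ℝ)..t₀, deriv (fun t => w t * w t) s := by
    refine intervalIntegral.integral_mono_ae_restrict ht₀.1 hint hac2.intervalIntegrable_deriv ?_
    have hne : ∀ᵐ s : ℝ, s ≠ t₀ := by simp [ae_iff, measure_singleton]
    rw [Filter.EventuallyLE, ae_restrict_iff' measurableSet_Icc]
    filter_upwards [hne, hgi.ae_hasDerivAt_integral] with s hs hd hsm
    have hsT : s ∈ Icc (0:ℝ) T := ⟨hsm.1, hsm.2.trans ht₀.2⟩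
    have hd' := hd (by rwa [uIcc_of_le hT.le]) 0 (by simp)
    have hE : HasDerivAt (fun t => Real.exp (K * t)) (Real.exp (K * s) * (K * 1)) s :=
      ((hasDerivAt_id s).const_mul K).exp
    have hW : HasDerivAt w (Real.exp (K * s) * (K * 1) * (A + ε + ∫ u in (0:ℝ)..s, g u)
        + Real.exp (K * s) * g s) s := hE.mul (hd'.const_add (A + ε))
    have hW' : HasDerivAt w (K * w s + Real.exp (K * s) * g s) s := by
      convert hW using 1
      simp only [hw]
      ring
    have hWW := (hW'.fun_mul hW').deriv
    rw [hWW]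
    have hyw := hlt s hsm.1 (lt_of_le_of_ne hsm.2 hs)
    have h0y := hy_nonneg s hsT
    have h0g := hg_nonneg s hsT
    have h0w := hwpos s hsT
    have he1 : 1 ≤ Real.exp (K * s) := Real.one_le_exp (mul_nonneg hK hsm.1)
    have a1 : g s * y s ≤ g s * w s := by gcongr
    have a2 : K * y s ^ 2 ≤ K * w s ^ 2 := by gcongr
    have a3 : g s * w s * 1 ≤ g s * w s * Real.exp (K * s) := by gcongr
    have a4 : 0 ≤ g s * w s := by positivity
    have a5 : 0 ≤ K * w s ^ 2 := by positivity
    nlinarith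
  rw [hac2.integral_deriv_eq_sub] at hmono
  have hw0 : w 0 = A + ε := by simp [hw]
  simp only [hw0] at hmono
  have h1 := hineq t₀ ht₀
  have h2 := hwpos t₀ ht₀
  have h3 : w t₀ * w t₀ ≤ y t₀ * y t₀ := mul_self_le_mul_self h2.le hyt₀
  nlinarith [mul_nonneg hA hε.le, mul_pos hε hε]
end

section
/- Let φ : ℝ³ → ℝ be a smooth function with compact support, and write points of ℝ³ as (t, θ¹, θ²). Then for every fixed (θ¹, θ²) ∈ ℝ² one has the trace inequality ∫_ℝ (∂_t φ(t, θ¹, θ²))² dt ≤ 2·( ‖∂_{θ¹}∂_{θ²} φ‖_{L²(ℝ³)} · ‖∂_t∂_t φ‖_{L²(ℝ³)} + ‖∂_{θ¹}∂_t φ‖_{L²(ℝ³)} · ‖∂_{θ²}∂_t φ‖_{L²(ℝ³)} ). -/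
open MeasureTheory

/-- The directional derivative of a function on `ℝ³`. -/
noncomputable def dirD (v : ℝ × ℝ × ℝ) (f : ℝ × ℝ × ℝ → ℝ) : ℝ × ℝ × ℝ → ℝ :=
  fun p => fderiv ℝ f p v

/-- Smooth with compact support. -/
def Nice (f : ℝ × ℝ × ℝ → ℝ) : Prop := ContDiff ℝ (⊤ : ℕ∞) f ∧ HasCompactSupport f

theorem Nice.dirD {f : ℝ × ℝ × ℝ → ℝ} (hf : Nice f) (v : ℝ × ℝ × ℝ) : Nice (dirD v f) := by
  refine ⟨?_, ?_⟩
  · exact (hf.1.fderiv_right (m := (⊤ : ℕ∞)) (by simp)).clm_apply contDiff_const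
  · exact hf.2.fderiv_apply (𝕜 := ℝ) v

theorem Nice.mul {f g : ℝ × ℝ × ℝ → ℝ} (hf : Nice f) (hg : Nice g) :
    Nice (fun p => f p * g p) :=
  ⟨hf.1.mul hg.1, hf.2.mul_right⟩

theorem Nice.add {f g : ℝ × ℝ × ℝ → ℝ} (hf : Nice f) (hg : Nice g) :
    Nice (fun p => f p + g p) :=
  ⟨hf.1.add hg.1, hf.2.add hg.2⟩

theorem Nice.diff {f : ℝ × ℝ × ℝ → ℝ} (hf : Nice f) : Differentiable ℝ f :=
  hf.1.differentiable (by simp)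

theorem Nice.integrable {f : ℝ × ℝ × ℝ → ℝ} (hf : Nice f) : Integrable f :=
  hf.1.continuous.integrable_of_hasCompactSupport hf.2

theorem dirD_mul {f g : ℝ × ℝ × ℝ → ℝ} (hf : Nice f) (hg : Nice g) (v : ℝ × ℝ × ℝ) :
    dirD v (fun p => f p * g p) = fun p => dirD v f p * g p + f p * dirD v g p := by
  funext p
  have := ((hf.diff p).hasFDerivAt.mul (hg.diff p).hasFDerivAt).fderiv
  simp only [dirD]
  erw [this]
  simp
  ring

theorem dirD_add {f g : ℝ × ℝ × ℝ → ℝ} (hf : Nice f) (hg : Nice g) (v : ℝ × ℝ × ℝ) :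
    dirD v (fun p => f p + g p) = fun p => dirD v f p + dirD v g p := by
  funext p
  have := ((hf.diff p).hasFDerivAt.add (hg.diff p).hasFDerivAt).fderiv
  simp only [dirD]
  erw [this]
  simp

theorem dirD_comm {f : ℝ × ℝ × ℝ → ℝ} (hf : Nice f) (v w : ℝ × ℝ × ℝ) :
    dirD v (dirD w f) = dirD w (dirD v f) := by
  funext p
  have hd : DifferentiableAt ℝ (fderiv ℝ f) p :=
    (hf.1.fderiv_right (m := (⊤ : ℕ∞)) (by simp)).differentiable (by simp) p
  have hs : IsSymmSndFDerivAt ℝ f p :=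
    hf.1.contDiffAt.isSymmSndFDerivAt (by simp; exact WithTop.coe_le_coe.2 le_top)
  have key : ∀ a b, dirD a (dirD b f) p = fderiv ℝ (fderiv ℝ f) p a b := by
    intro a b
    have h := (hd.hasFDerivAt.clm_apply (hasFDerivAt_const b p)).fderiv
    change fderiv ℝ (fun y => fderiv ℝ f y b) p a = _
    rw [h]
    simp
  rw [key, key]
  exact hs v w

theorem hasDeriv_t {f : ℝ × ℝ × ℝ → ℝ} (hf : Nice f) (t a b : ℝ) :
    HasDerivAt (fun s => f (s, a, b)) (dirD (1, 0, 0) f (t, a, b)) t :=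
  (hf.diff (t, a, b)).hasFDerivAt.comp_hasDerivAt t
    ((hasDerivAt_id t).prodMk ((hasDerivAt_const t a).prodMk (hasDerivAt_const t b)))

theorem hasDeriv_a {f : ℝ × ℝ × ℝ → ℝ} (hf : Nice f) (t a b : ℝ) :
    HasDerivAt (fun s => f (t, s, b)) (dirD (0, 1, 0) f (t, a, b)) a :=
  (hf.diff (t, a, b)).hasFDerivAt.comp_hasDerivAt a
    ((hasDerivAt_const a t).prodMk ((hasDerivAt_id a).prodMk (hasDerivAt_const a b)))

theorem hasDeriv_b {f : ℝ × ℝ × ℝ → ℝ} (hf : Nice f) (t a b : ℝ) :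
    HasDerivAt (fun s => f (t, a, s)) (dirD (0, 0, 1) f (t, a, b)) b :=
  (hf.diff (t, a, b)).hasFDerivAt.comp_hasDerivAt b
    ((hasDerivAt_const b t).prodMk ((hasDerivAt_const b a).prodMk (hasDerivAt_id b)))

theorem slice_t {f : ℝ × ℝ × ℝ → ℝ} (hf : Nice f) (a b : ℝ) :
    HasCompactSupport (fun s => f (s, a, b)) :=
  HasCompactSupport.intro (hf.2.isCompact.image continuous_fst) fun x hx =>
    image_eq_zero_of_notMem_tsupport fun h => hx ⟨_, h, rfl⟩

theorem slice_a {f : ℝ × ℝ × ℝ → ℝ} (hf : Nice f) (t b : ℝ) :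
    HasCompactSupport (fun s => f (t, s, b)) :=
  HasCompactSupport.intro (hf.2.isCompact.image (continuous_fst.comp continuous_snd)) fun x hx =>
    image_eq_zero_of_notMem_tsupport fun h => hx ⟨_, h, rfl⟩

theorem slice_b {f : ℝ × ℝ × ℝ → ℝ} (hf : Nice f) (t a : ℝ) :
    HasCompactSupport (fun s => f (t, a, s)) :=
  HasCompactSupport.intro (hf.2.isCompact.image (continuous_snd.comp continuous_snd)) fun x hx =>
    image_eq_zero_of_notMem_tsupport fun h => hx ⟨_, h, rfl⟩

theorem int_t {f : ℝ × ℝ × ℝ → ℝ} (hf : Nice f) (a b : ℝ) :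
    ∫ t, dirD (1, 0, 0) f (t, a, b) = 0 := by
  have hc : Continuous (fun s => f (s, a, b)) := hf.1.continuous.comp (by fun_prop)
  have hc' : Continuous (fun s => dirD (1, 0, 0) f (s, a, b)) :=
    (hf.dirD _).1.continuous.comp (by fun_prop)
  exact integral_eq_zero_of_hasDerivAt_of_integrable (fun t => hasDeriv_t hf t a b)
    (hc'.integrable_of_hasCompactSupport (slice_t (hf.dirD _) a b))
    (hc.integrable_of_hasCompactSupport (slice_t hf a b))

theorem int_a {f : ℝ × ℝ × ℝ → ℝ} (hf : Nice f) (t x b : ℝ) :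
    ∫ a in Set.Iic x, dirD (0, 1, 0) f (t, a, b) = f (t, x, b) := by
  have hc : ContDiff ℝ 1 (fun s => f (t, s, b)) :=
    (hf.1.of_le (by exact_mod_cast le_top)).comp (by fun_prop)
  have := HasCompactSupport.integral_Iic_deriv_eq hc (slice_a hf t b) x
  rw [← this]
  simp only [(hasDeriv_a hf t _ b).deriv]

theorem int_b {f : ℝ × ℝ × ℝ → ℝ} (hf : Nice f) (t a x : ℝ) :
    ∫ b in Set.Iic x, dirD (0, 0, 1) f (t, a, b) = f (t, a, x) := by
  have hc : ContDiff ℝ 1 (fun s => f (t, a, s)) :=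
    (hf.1.of_le (by exact_mod_cast le_top)).comp (by fun_prop)
  have := HasCompactSupport.integral_Iic_deriv_eq hc (slice_b hf t a) x
  rw [← this]
  simp only [(hasDeriv_b hf t a _).deriv]

/-- The half-space product `ℝ × (-∞, x] × (-∞, y]` as a measure. -/
noncomputable def halfM (x y : ℝ) : Measure (ℝ × ℝ × ℝ) :=
  (volume : Measure ℝ).prod
    ((volume.restrict (Set.Iic x) : Measure ℝ).prod (volume.restrict (Set.Iic y) : Measure ℝ))

theorem halfM_eq (x y : ℝ) :
    halfM x y = volume.restrict (Set.univ ×ˢ (Set.Iic x ×ˢ Set.Iic y)) := by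
  rw [halfM, Measure.volume_eq_prod, ← Measure.prod_restrict, Measure.restrict_univ,
    Measure.volume_eq_prod, ← Measure.prod_restrict]

theorem Nice.integrable_half {f : ℝ × ℝ × ℝ → ℝ} (hf : Nice f) (x y : ℝ) :
    Integrable f (halfM x y) := by
  rw [halfM_eq]; exact hf.integrable.restrict

theorem half_ab {f : ℝ × ℝ × ℝ → ℝ} (hf : Nice f) (x y : ℝ) :
    ∫ p, dirD (0, 0, 1) (dirD (0, 1, 0) f) p ∂(halfM x y) = ∫ t, f (t, x, y) := by
  have hg := (hf.dirD (0, 1, 0)).dirD (0, 0, 1)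
  rw [halfM, integral_prod _ (hg.integrable_half x y)]
  congr 1
  funext t
  rw [integral_prod]
  · simp only [int_b (hf.dirD (0, 1, 0)), int_a hf]
  · have hc : Continuous (fun q : ℝ × ℝ => dirD (0, 0, 1) (dirD (0, 1, 0) f) (t, q)) :=
      hg.1.continuous.comp (by fun_prop)
    have hs : HasCompactSupport
        (fun q : ℝ × ℝ => dirD (0, 0, 1) (dirD (0, 1, 0) f) (t, q)) :=
      HasCompactSupport.intro (hg.2.isCompact.image continuous_snd) fun x hx =>
        image_eq_zero_of_notMem_tsupport fun h => hx ⟨_, h, rfl⟩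
    rw [Measure.prod_restrict]
    exact (hc.integrable_of_hasCompactSupport hs).restrict

theorem half_t {f : ℝ × ℝ × ℝ → ℝ} (hf : Nice f) (x y : ℝ) :
    ∫ p, dirD (1, 0, 0) f p ∂(halfM x y) = 0 := by
  have hg := (hf.dirD (1, 0, 0))
  rw [halfM, integral_prod_symm _ (hg.integrable_half x y)]
  simp [int_t hf]

theorem half_cs {u v : ℝ × ℝ × ℝ → ℝ} (hu : Nice u) (hv : Nice v) (x y : ℝ) :
    |∫ p, u p * v p ∂(halfM x y)| ≤
      Real.sqrt (∫ p, (u p) ^ 2) * Real.sqrt (∫ p, (v p) ^ 2) := by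
  have hi := (hu.mul hv).integrable
  have hmem : ∀ {w : ℝ × ℝ × ℝ → ℝ}, Nice w → MemLp (fun p => |w p|) (ENNReal.ofReal 2) volume :=
    fun {w} hw => (hw.1.continuous.memLp_of_hasCompactSupport hw.2).norm
  calc |∫ p, u p * v p ∂(halfM x y)| ≤ ∫ p, |u p * v p| ∂(halfM x y) :=
        abs_integral_le_integral_abs
    _ ≤ ∫ p, |u p * v p| := by
        rw [halfM_eq]
        exact setIntegral_le_integral hi.abs (Filter.Eventually.of_forall fun p => abs_nonneg _)
    _ ≤ _ := by
        have := integral_mul_le_Lp_mul_Lq_of_nonneg (μ := (volume : Measure (ℝ × ℝ × ℝ)))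
          Real.HolderConjugate.two_two
          (Filter.Eventually.of_forall fun p => abs_nonneg (u p))
          (Filter.Eventually.of_forall fun p => abs_nonneg (v p)) (hmem hu) (hmem hv)
        simpa [abs_mul, Real.sqrt_eq_rpow] using this

theorem key_ineq {f : ℝ × ℝ × ℝ → ℝ} (hf : Nice f) (x y : ℝ) :
    (∫ t : ℝ, (dirD (1, 0, 0) f (t, x, y)) ^ 2) ≤
      2 * (Real.sqrt (∫ p, (dirD (0, 1, 0) (dirD (0, 0, 1) f) p) ^ 2) *
            Real.sqrt (∫ p, (dirD (1, 0, 0) (dirD (1, 0, 0) f) p) ^ 2)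
          + Real.sqrt (∫ p, (dirD (0, 1, 0) (dirD (1, 0, 0) f) p) ^ 2) *
            Real.sqrt (∫ p, (dirD (0, 0, 1) (dirD (1, 0, 0) f) p) ^ 2)) := by
  have ht := hf.dirD (1, 0, 0)
  have hta := ht.dirD (0, 1, 0)
  have htb := ht.dirD (0, 0, 1)
  have htt := ht.dirD (1, 0, 0)
  have htab := hta.dirD (0, 0, 1)
  have hab := (hf.dirD (0, 0, 1)).dirD (0, 1, 0)
  have h1 := half_ab (ht.mul ht) x y
  have h2 := half_t (ht.mul hab) x y
  rw [dirD_mul ht ht, dirD_add (hta.mul ht) (ht.mul hta), dirD_mul hta ht, dirD_mul ht hta] at h1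
  rw [dirD_mul ht hab] at h2
  have hc : dirD (1, 0, 0) (dirD (0, 1, 0) (dirD (0, 0, 1) f))
      = dirD (0, 0, 1) (dirD (0, 1, 0) (dirD (1, 0, 0) f)) := by
    rw [dirD_comm (hf.dirD _), dirD_comm hf (1, 0, 0), dirD_comm (hf.dirD _) (0, 1, 0)]
  rw [hc] at h2
  have e1 := half_cs hab htt x y
  have e2 := half_cs hta htb x y
  have i1 := (hab.mul htt).integrable_half x y
  have i2 := (hta.mul htb).integrable_half x y
  have i3 := (ht.mul htab).integrable_half x y
  have h1' : ∫ t, (dirD (1, 0, 0) f (t, x, y)) ^ 2 =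
      2 * (∫ p, dirD (0, 1, 0) (dirD (1, 0, 0) f) p * dirD (0, 0, 1) (dirD (1, 0, 0) f) p
        ∂(halfM x y)) + 2 * ∫ p, dirD (1, 0, 0) f p *
          dirD (0, 0, 1) (dirD (0, 1, 0) (dirD (1, 0, 0) f)) p ∂(halfM x y) := by
    rw [← integral_const_mul, ← integral_const_mul, ← integral_add (i2.const_mul 2)
      (i3.const_mul 2)]
    simp only [pow_two]
    rw [← h1]
    congr 1
    funext p
    ring
  have h2' : (∫ p, dirD (0, 1, 0) (dirD (0, 0, 1) f) p * dirD (1, 0, 0) (dirD (1, 0, 0) f) p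
        ∂(halfM x y)) + ∫ p, dirD (1, 0, 0) f p *
          dirD (0, 0, 1) (dirD (0, 1, 0) (dirD (1, 0, 0) f)) p ∂(halfM x y) = 0 := by
    rw [← integral_add i1 i3]
    refine Eq.trans ?_ h2
    congr 1
    funext p
    ring
  rw [h1']
  have := neg_abs_le (∫ p, dirD (0, 1, 0) (dirD (0, 0, 1) f) p *
    dirD (1, 0, 0) (dirD (1, 0, 0) f) p ∂(halfM x y))
  have := le_abs_self (∫ p, dirD (0, 1, 0) (dirD (1, 0, 0) f) p *
    dirD (0, 0, 1) (dirD (1, 0, 0) f) p ∂(halfM x y))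
  linarith


/-- Euclidean-coordinate core of the codimension-one trace estimate: for a smooth
compactly supported `φ : ℝ³ → ℝ` (points written `(t, θ¹, θ²)`), the square integral of
`∂ₜφ` along any line in the `t`-direction is controlled by products of `L²(ℝ³)` norms
of second derivatives. -/
theorem trace_inequality_line
    (φ : ℝ → ℝ → ℝ → ℝ)
    (hφ : ContDiff ℝ (⊤ : ℕ∞) (fun p : ℝ × ℝ × ℝ => φ p.1 p.2.1 p.2.2))
    (hsupp : HasCompactSupport (fun p : ℝ × ℝ × ℝ => φ p.1 p.2.1 p.2.2))
    (θ₁ θ₂ : ℝ) :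
    (∫ t : ℝ, (deriv (fun s => φ s θ₁ θ₂) t) ^ 2) ≤
      2 * (Real.sqrt (∫ p : ℝ × ℝ × ℝ,
              (deriv (fun a => deriv (fun b => φ p.1 a b) p.2.2) p.2.1) ^ 2) *
            Real.sqrt (∫ p : ℝ × ℝ × ℝ,
              (deriv (fun s => deriv (fun s' => φ s' p.2.1 p.2.2) s) p.1) ^ 2)
          + Real.sqrt (∫ p : ℝ × ℝ × ℝ,
              (deriv (fun a => deriv (fun s => φ s a p.2.2) p.1) p.2.1) ^ 2) *
            Real.sqrt (∫ p : ℝ × ℝ × ℝ,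
              (deriv (fun b => deriv (fun s => φ s p.2.1 b) p.1) p.2.2) ^ 2)) := by
  have hf : Nice (fun p : ℝ × ℝ × ℝ => φ p.1 p.2.1 p.2.2) := ⟨hφ, hsupp⟩
  have key := key_ineq hf θ₁ θ₂
  have dt : ∀ t a b, deriv (fun s => φ s a b) t
      = dirD (1, 0, 0) (fun p : ℝ × ℝ × ℝ => φ p.1 p.2.1 p.2.2) (t, a, b) :=
    fun t a b => (hasDeriv_t hf t a b).deriv
  have db : ∀ t a b, deriv (fun s => φ t a s) b
      = dirD (0, 0, 1) (fun p : ℝ × ℝ × ℝ => φ p.1 p.2.1 p.2.2) (t, a, b) :=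
    fun t a b => (hasDeriv_b hf t a b).deriv
  simp only [dt, db]
  simp only [(hasDeriv_t (hf.dirD _) _ _ _).deriv, (hasDeriv_a (hf.dirD _) _ _ _).deriv,
    (hasDeriv_b (hf.dirD _) _ _ _).deriv]
  exact key
end

section
/- There exists a constant C > 0 such that for every smooth, compactly supported function φ : ℝ³ → ℝ, writing points of ℝ³ as (t, θ) with θ = (θ¹, θ²) ∈ ℝ², and for every t₀ ∈ ℝ, the restriction φ(t₀, ·) : ℝ² → ℝ satisfies ‖φ(t₀, ·)‖_{L⁴(ℝ²)} ≤ C·( ‖φ‖_{L²(ℝ³)} + ‖∇_θ φ‖_{L²(ℝ³)} )^{1/2} · ( ‖φ‖_{L²(ℝ³)} + ‖∂_t φ‖_{L²(ℝ³)} )^{1/2}. -/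
open MeasureTheory
open scoped ENNReal

lemma cs_sq {α : Type*} [MeasurableSpace α] (μ : Measure α) {f g : α → ℝ≥0∞}
    (hf : AEMeasurable f μ) (hg : AEMeasurable g μ) :
    (∫⁻ x, f x * g x ∂μ) ^ 2 ≤ (∫⁻ x, f x ^ 2 ∂μ) * ∫⁻ x, g x ^ 2 ∂μ := by
  have h := ENNReal.lintegral_mul_le_Lp_mul_Lq μ Real.HolderConjugate.two_two hf hg
  simp only [Pi.mul_apply, ENNReal.rpow_ofNat] at h
  calc _ ≤ _ := pow_le_pow_left' h 2
    _ = _ := by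
      rw [mul_pow, ← ENNReal.rpow_mul_natCast, ← ENNReal.rpow_mul_natCast]
      norm_num

lemma abstract_bound (u a b c : ℝ → ℝ → ℝ → ℝ≥0∞)
    (hu : Measurable (fun p : ℝ × ℝ × ℝ => u p.1 p.2.1 p.2.2))
    (ha : Measurable (fun p : ℝ × ℝ × ℝ => a p.1 p.2.1 p.2.2))
    (hb : Measurable (fun p : ℝ × ℝ × ℝ => b p.1 p.2.1 p.2.2))
    (hc : Measurable (fun p : ℝ × ℝ × ℝ => c p.1 p.2.1 p.2.2))
    (h1 : ∀ t x y, u t x y ^ 4 ≤ 4 * ∫⁻ s, u s x y ^ 3 * a s x y)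
    (h2 : ∀ t x y, u t x y ^ 3 ≤ 3 * ∫⁻ s, u t s y ^ 2 * b t s y)
    (h3 : ∀ t x y, u t x y ^ 3 ≤ 3 * ∫⁻ s, u t x s ^ 2 * c t x s)
    (hI : ∫⁻ p : ℝ × ℝ × ℝ, u p.1 p.2.1 p.2.2 ^ 6 ≠ ∞) (t : ℝ) :
    ∫⁻ p : ℝ × ℝ, u t p.1 p.2 ^ 4 ≤ 144 * (∫⁻ p : ℝ × ℝ × ℝ, a p.1 p.2.1 p.2.2 ^ 2) *
      ∫⁻ p : ℝ × ℝ × ℝ, (b p.1 p.2.1 p.2.2 ^ 2 + c p.1 p.2.1 p.2.2 ^ 2) := by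
  set A := ∫⁻ p : ℝ × ℝ × ℝ, a p.1 p.2.1 p.2.2 ^ 2 with hA
  set D := ∫⁻ p : ℝ × ℝ × ℝ, (b p.1 p.2.1 p.2.2 ^ 2 + c p.1 p.2.1 p.2.2 ^ 2) with hD
  set I := ∫⁻ p : ℝ × ℝ × ℝ, u p.1 p.2.1 p.2.2 ^ 6 with hIdef
  have slice : ∀ {f : ℝ → ℝ → ℝ → ℝ≥0∞}, Measurable (fun p : ℝ × ℝ × ℝ => f p.1 p.2.1 p.2.2) →
      ∀ t, Measurable (fun p : ℝ × ℝ => f t p.1 p.2) := by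
    intro f hf t
    exact hf.comp (measurable_const.prodMk measurable_id)
  -- slice bound
  have key1 : ∀ t, (∫⁻ p : ℝ × ℝ, u t p.1 p.2 ^ 4) ^ 2 ≤ 16 * (I * A) := by
    intro t
    have hs : ∫⁻ p : ℝ × ℝ, u t p.1 p.2 ^ 4 ≤
        4 * ∫⁻ p : ℝ × ℝ × ℝ, u p.1 p.2.1 p.2.2 ^ 3 * a p.1 p.2.1 p.2.2 := by
      rw [Measure.volume_eq_prod, Measure.volume_eq_prod ℝ (ℝ × ℝ), lintegral_prod_symm _
        (show Measurable (fun p : ℝ × ℝ × ℝ => u p.1 p.2.1 p.2.2 ^ 3 * a p.1 p.2.1 p.2.2) from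
          (hu.pow_const 3).mul ha).aemeasurable, ← lintegral_const_mul' _ _ (by norm_num)]
      exact lintegral_mono fun p => h1 t p.1 p.2
    have hcs := cs_sq (volume : Measure (ℝ × ℝ × ℝ)) (hu.pow_const 3).aemeasurable ha.aemeasurable
    simp only [← pow_mul] at hcs
    calc _ ≤ _ := pow_le_pow_left' hs 2
      _ ≤ _ := by
        rw [mul_pow]
        norm_num
        exact mul_le_mul_right hcs _
  -- bound of u^6 on slices
  have key2 : ∀ t, ∫⁻ p : ℝ × ℝ, u t p.1 p.2 ^ 6 ≤ 9 * ((∫⁻ p : ℝ × ℝ, u t p.1 p.2 ^ 4) *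
      ∫⁻ p : ℝ × ℝ, (b t p.1 p.2 ^ 2 + c t p.1 p.2 ^ 2)) := by
    intro t
    have hut := slice hu t
    have hbt := slice hb t
    have hct := slice hc t
    set G := ∫⁻ p : ℝ × ℝ, u t p.1 p.2 ^ 4
    set E := ∫⁻ p : ℝ × ℝ, (b t p.1 p.2 ^ 2 + c t p.1 p.2 ^ 2)
    set P := ∫⁻ p : ℝ × ℝ, u t p.1 p.2 ^ 2 * b t p.1 p.2 with hP
    set Q := ∫⁻ p : ℝ × ℝ, u t p.1 p.2 ^ 2 * c t p.1 p.2 with hQ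
    have mb : Measurable (fun p : ℝ × ℝ => u t p.1 p.2 ^ 2 * b t p.1 p.2) := (hut.pow_const 2).mul hbt
    have mc : Measurable (fun p : ℝ × ℝ => u t p.1 p.2 ^ 2 * c t p.1 p.2) := (hut.pow_const 2).mul hct
    have h6 : ∫⁻ p : ℝ × ℝ, u t p.1 p.2 ^ 6 ≤ 9 * (Q * P) := by
      have e1 : P = ∫⁻ y, ∫⁻ s, u t s y ^ 2 * b t s y := by
        rw [hP, Measure.volume_eq_prod, lintegral_prod_symm _ mb.aemeasurable]
      have e2 : Q = ∫⁻ x, ∫⁻ s, u t x s ^ 2 * c t x s := by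
        rw [hQ, Measure.volume_eq_prod, lintegral_prod _ mc.aemeasurable]
      have mb' : Measurable fun y => ∫⁻ s, u t s y ^ 2 * b t s y :=
        Measurable.lintegral_prod_left' mb
      have mc' : Measurable fun x => ∫⁻ s, u t x s ^ 2 * c t x s :=
        Measurable.lintegral_prod_right' mc
      rw [e1, e2, ← lintegral_prod_mul mc'.aemeasurable mb'.aemeasurable,
        ← lintegral_const_mul' _ _ (by norm_num), Measure.volume_eq_prod]
      refine lintegral_mono fun p => ?_
      calc u t p.1 p.2 ^ 6 = u t p.1 p.2 ^ 3 * u t p.1 p.2 ^ 3 := by ring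
        _ ≤ _ := mul_le_mul' (h3 t p.1 p.2) (h2 t p.1 p.2)
        _ = _ := by ring
    have hP2 : P ^ 2 ≤ G * E := by
      have hcs := cs_sq (volume : Measure (ℝ × ℝ)) (hut.pow_const 2).aemeasurable hbt.aemeasurable
      simp only [← pow_mul] at hcs
      exact hcs.trans (mul_le_mul' le_rfl (lintegral_mono fun p => le_self_add))
    have hQ2 : Q ^ 2 ≤ G * E := by
      have hcs := cs_sq (volume : Measure (ℝ × ℝ)) (hut.pow_const 2).aemeasurable hct.aemeasurable
      simp only [← pow_mul] at hcs
      exact hcs.trans (mul_le_mul' le_rfl (lintegral_mono fun p => le_add_self))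
    have hPQ : Q * P ≤ G * E := by
      rw [← ENNReal.pow_le_pow_left_iff two_ne_zero, mul_pow, sq (G * E)]
      exact mul_le_mul' hQ2 hP2
    exact h6.trans (mul_le_mul' le_rfl hPQ)
  set S := (16 * (I * A)) ^ ((2:ℝ)⁻¹) with hS
  have hS2 : S ^ 2 ≤ 16 * (I * A) := by
    rw [hS, ← ENNReal.rpow_mul_natCast]
    norm_num
  have hle : ∀ t, ∫⁻ p : ℝ × ℝ, u t p.1 p.2 ^ 4 ≤ S := by
    intro t
    rw [hS, ENNReal.le_rpow_inv_iff (by norm_num), ENNReal.rpow_ofNat]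
    exact key1 t
  have md : Measurable (fun p : ℝ × ℝ × ℝ => b p.1 p.2.1 p.2.2 ^ 2 + c p.1 p.2.1 p.2.2 ^ 2) :=
    (hb.pow_const 2).add (hc.pow_const 2)
  have hI9 : I ≤ 9 * (S * D) := by
    rw [hIdef, hD, Measure.volume_eq_prod ℝ (ℝ × ℝ), lintegral_prod _ (hu.pow_const 6).aemeasurable,
      lintegral_prod _ md.aemeasurable,
      ← lintegral_const_mul _ (Measurable.lintegral_prod_right' md),
      ← lintegral_const_mul' _ _ (by norm_num)]
    refine lintegral_mono fun t => (key2 t).trans ?_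
    refine mul_le_mul' le_rfl (mul_le_mul' ?_ le_rfl)
    exact hle t
  have hIb : I ≤ 1296 * (A * D ^ 2) := by
    by_cases h0 : I = 0
    · rw [h0]; exact zero_le
    · rw [← ENNReal.mul_le_mul_iff_right h0 hI]
      calc I * I = I ^ 2 := by ring
        _ ≤ _ := pow_le_pow_left' hI9 2
        _ = 81 * (S ^ 2 * D ^ 2) := by ring
        _ ≤ 81 * ((16 * (I * A)) * D ^ 2) := by gcongr
        _ = _ := by ring
  rw [← ENNReal.pow_le_pow_left_iff two_ne_zero]
  calc _ ≤ _ := key1 t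
    _ ≤ 16 * ((1296 * (A * D ^ 2)) * A) := by gcongr
    _ = _ := by ring

lemma one_dim (g : ℝ → ℝ) (hg : ContDiff ℝ 1 g) (hs : HasCompactSupport g) (n : ℕ) (x : ℝ) :
    ‖g x‖ₑ ^ (n + 1) ≤ (n + 1 : ℕ) * ∫⁻ s, ‖g s‖ₑ ^ n * ‖deriv g s‖ₑ := by
  have hs' : HasCompactSupport (fun s => g s ^ (n + 1)) := by
    refine hs.mono fun s h h0 => h ?_
    simp [h0]
  have h := HasCompactSupport.enorm_le_lintegral_Ici_deriv (hg.pow (n + 1)) hs' x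
  rw [enorm_pow] at h
  refine h.trans ((setLIntegral_le_lintegral _ _).trans ?_)
  rw [← lintegral_const_mul' _ _ (by simp)]
  refine lintegral_mono fun s => le_of_eq ?_
  have hd : deriv (fun s => g s ^ (n + 1)) s = ((n + 1 : ℕ) : ℝ) * (g s ^ n * deriv g s) := by
    rw [deriv_fun_pow (hg.differentiable one_ne_zero s)]
    simp [mul_assoc]
  rw [hd, enorm_mul, enorm_mul, enorm_pow]
  congr 1
  rw [Real.enorm_natCast]

lemma trace_sq (φ : ℝ → ℝ → ℝ → ℝ)
    (hf : ContDiff ℝ (⊤ : ℕ∞) (fun p : ℝ × ℝ × ℝ => φ p.1 p.2.1 p.2.2))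
    (hc : HasCompactSupport (fun p : ℝ × ℝ × ℝ => φ p.1 p.2.1 p.2.2)) (t₀ : ℝ) :
    (∫ θ : ℝ × ℝ, |φ t₀ θ.1 θ.2| ^ 4) ≤
      144 * (∫ p : ℝ × ℝ × ℝ, (deriv (fun s => φ s p.2.1 p.2.2) p.1) ^ 2) *
        ∫ p : ℝ × ℝ × ℝ, ((deriv (fun a => φ p.1 a p.2.2) p.2.1) ^ 2 +
                   (deriv (fun b => φ p.1 p.2.1 b) p.2.2) ^ 2) := by
  set f := fun p : ℝ × ℝ × ℝ => φ p.1 p.2.1 p.2.2 with hfdef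
  have hf1 : ContDiff ℝ 1 f := hf.of_le (by exact_mod_cast le_top)
  have hdf : ∀ p, HasFDerivAt f (fderiv ℝ f p) p := fun p =>
    (hf1.differentiable one_ne_zero p).hasFDerivAt
  have da : ∀ t x y, deriv (fun s => φ s x y) t = fderiv ℝ f (t, x, y) (1, 0, 0) := by
    intro t x y
    have h : HasDerivAt (fun s : ℝ => (s, x, y)) ((1:ℝ), (0:ℝ), (0:ℝ)) t :=
      (hasDerivAt_id t).prodMk ((hasDerivAt_const t x).prodMk (hasDerivAt_const t y))
    exact ((hdf (t, x, y)).comp_hasDerivAt t h).deriv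
  have db : ∀ t x y, deriv (fun s => φ t s y) x = fderiv ℝ f (t, x, y) (0, 1, 0) := by
    intro t x y
    have h : HasDerivAt (fun s : ℝ => (t, s, y)) ((0:ℝ), (1:ℝ), (0:ℝ)) x :=
      (hasDerivAt_const x t).prodMk ((hasDerivAt_id x).prodMk (hasDerivAt_const x y))
    exact ((hdf (t, x, y)).comp_hasDerivAt x h).deriv
  have dc : ∀ t x y, deriv (fun s => φ t x s) y = fderiv ℝ f (t, x, y) (0, 0, 1) := by
    intro t x y
    have h : HasDerivAt (fun s : ℝ => (t, x, s)) ((0:ℝ), (0:ℝ), (1:ℝ)) y :=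
      (hasDerivAt_const y t).prodMk ((hasDerivAt_const y x).prodMk (hasDerivAt_id y))
    exact ((hdf (t, x, y)).comp_hasDerivAt y h).deriv
  have cD : ∀ v, Continuous fun p : ℝ × ℝ × ℝ => fderiv ℝ f p v := fun v =>
    (hf1.continuous_fderiv one_ne_zero).clm_apply continuous_const
  have sD : ∀ v, HasCompactSupport fun p : ℝ × ℝ × ℝ => fderiv ℝ f p v := fun v =>
    hc.fderiv_apply (𝕜 := ℝ) v
  have iD : ∀ v, Integrable fun p : ℝ × ℝ × ℝ => (fderiv ℝ f p v) ^ 2 := by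
    intro v
    refine ((cD v).pow 2).integrable_of_hasCompactSupport ((sD v).mono fun s h h0 => h ?_)
    simp [h0]
  have iBC : Integrable fun p : ℝ × ℝ × ℝ => (fderiv ℝ f (p.1, p.2.1, p.2.2)) (0, 1, 0) ^ 2 +
      (fderiv ℝ f (p.1, p.2.1, p.2.2)) (0, 0, 1) ^ 2 := (iD (0,1,0)).add (iD (0,0,1))
  have cs2 : HasCompactSupport (fun p : ℝ × ℝ => φ t₀ p.1 p.2) := by
    refine HasCompactSupport.intro (hc.isCompact.image continuous_snd) fun p hp => ?_
    by_contra h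
    exact hp ⟨(t₀, p), subset_tsupport f h, rfl⟩
  have cs1 : ∀ x y, HasCompactSupport (fun s => φ s x y) := by
    intro x y
    refine HasCompactSupport.intro (hc.isCompact.image continuous_fst) fun p hp => ?_
    by_contra h
    exact hp ⟨(p, x, y), subset_tsupport f h, rfl⟩
  have cs3 : ∀ t y, HasCompactSupport (fun s => φ t s y) := by
    intro x y
    refine HasCompactSupport.intro (hc.isCompact.image (continuous_fst.comp continuous_snd))
      fun p hp => ?_
    by_contra h
    exact hp ⟨(x, p, y), subset_tsupport f h, rfl⟩
  have cs4 : ∀ t x, HasCompactSupport (fun s => φ t x s) := by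
    intro x y
    refine HasCompactSupport.intro (hc.isCompact.image (continuous_snd.comp continuous_snd))
      fun p hp => ?_
    by_contra h
    exact hp ⟨(x, y, p), subset_tsupport f h, rfl⟩
  have i6 : Integrable fun p => f p ^ 6 := by
    refine (hf1.continuous.pow 6).integrable_of_hasCompactSupport (hc.mono fun s h h0 => h ?_)
    simp [h0]
  have i4 : Integrable fun p : ℝ × ℝ => |φ t₀ p.1 p.2| ^ 4 := by
    have : Continuous fun p : ℝ × ℝ => φ t₀ p.1 p.2 :=
      hf1.continuous.comp (continuous_const.prodMk continuous_id)
    refine (this.abs.pow 4).integrable_of_hasCompactSupport (cs2.mono fun s h h0 => h ?_)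
    simp [h0]
  have key := abstract_bound (fun t x y => ‖φ t x y‖ₑ)
    (fun t x y => ‖fderiv ℝ f (t, x, y) (1, 0, 0)‖ₑ)
    (fun t x y => ‖fderiv ℝ f (t, x, y) (0, 1, 0)‖ₑ)
    (fun t x y => ‖fderiv ℝ f (t, x, y) (0, 0, 1)‖ₑ)
    hf1.continuous.enorm.measurable (cD _).enorm.measurable (cD _).enorm.measurable
    (cD _).enorm.measurable
    (by
      intro t x y
      simp only [← da]
      exact_mod_cast one_dim (fun s => φ s x y)
        (hf1.comp (contDiff_id.prodMk (contDiff_const (c := (x, y))))) (cs1 x y) 3 t)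
    (by
      intro t x y
      simp only [← db]
      exact_mod_cast one_dim (fun s => φ t s y)
        (hf1.comp (contDiff_const.prodMk (contDiff_id.prodMk contDiff_const))) (cs3 t y) 2 x)
    (by
      intro t x y
      simp only [← dc]
      exact_mod_cast one_dim (fun s => φ t x s)
        (hf1.comp (contDiff_const.prodMk (contDiff_const.prodMk contDiff_id))) (cs4 t x) 2 y)
    (by
      have := i6.2.ne
      simpa only [enorm_pow] using this) t₀
  simp only [da, db, dc]
  have e : ∀ x : ℝ, ∀ n, ‖x‖ₑ ^ n = ENNReal.ofReal (|x| ^ n) := by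
    intro x n
    rw [← enorm_pow, ← abs_pow, Real.enorm_eq_ofReal_abs]
  simp only [e, sq_abs] at key
  simp only [← ENNReal.ofReal_add (sq_nonneg _) (sq_nonneg _)] at key
  rw [← ofReal_integral_eq_lintegral_ofReal i4 (ae_of_all _ fun _ => by positivity),
    ← ofReal_integral_eq_lintegral_ofReal (iD _) (ae_of_all _ fun _ => by positivity),
    ← ofReal_integral_eq_lintegral_ofReal iBC
      (ae_of_all _ fun _ => by positivity),
    ← ENNReal.ofReal_ofNat, ← ENNReal.ofReal_mul (by norm_num), ← ENNReal.ofReal_mul (by positivity)]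
    at key
  exact (ENNReal.ofReal_le_ofReal_iff (by positivity)).1 key




/-- Flat (Euclidean slab) model of the anisotropic codimension-one `L⁴(S)` trace
estimate: the `L⁴` norm of a smooth compactly supported `φ : ℝ³ → ℝ` on a slice
`{t = t₀}` is controlled by the geometric mean of the `L²(ℝ³)` norm of `φ` plus its
tangential derivatives and the `L²(ℝ³)` norm of `φ` plus its transversal derivative. -/
theorem trace_L4_slice :
    ∃ C > (0:ℝ), ∀ (φ : ℝ → ℝ → ℝ → ℝ),
      ContDiff ℝ (⊤ : ℕ∞) (fun p : ℝ × ℝ × ℝ => φ p.1 p.2.1 p.2.2) →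
      HasCompactSupport (fun p : ℝ × ℝ × ℝ => φ p.1 p.2.1 p.2.2) →
      ∀ t₀ : ℝ,
      (∫ θ : ℝ × ℝ, |φ t₀ θ.1 θ.2| ^ 4) ^ ((1:ℝ)/4) ≤
        C * Real.sqrt ((∫ p : ℝ × ℝ × ℝ, (φ p.1 p.2.1 p.2.2) ^ 2) ^ ((1:ℝ)/2)
              + (∫ p : ℝ × ℝ × ℝ,
                  ((deriv (fun a => φ p.1 a p.2.2) p.2.1) ^ 2 +
                   (deriv (fun b => φ p.1 p.2.1 b) p.2.2) ^ 2)) ^ ((1:ℝ)/2))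
          * Real.sqrt ((∫ p : ℝ × ℝ × ℝ, (φ p.1 p.2.1 p.2.2) ^ 2) ^ ((1:ℝ)/2)
              + (∫ p : ℝ × ℝ × ℝ, (deriv (fun s => φ s p.2.1 p.2.2) p.1) ^ 2) ^ ((1:ℝ)/2)) := by
  refine ⟨4, by norm_num, fun φ hf hc t₀ => ?_⟩
  have h := trace_sq φ hf hc t₀
  set F := ∫ θ : ℝ × ℝ, |φ t₀ θ.1 θ.2| ^ 4
  set U := ∫ p : ℝ × ℝ × ℝ, (φ p.1 p.2.1 p.2.2) ^ 2
  set A := ∫ p : ℝ × ℝ × ℝ, (deriv (fun s => φ s p.2.1 p.2.2) p.1) ^ 2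
  set D := ∫ p : ℝ × ℝ × ℝ, ((deriv (fun a => φ p.1 a p.2.2) p.2.1) ^ 2 +
                   (deriv (fun b => φ p.1 p.2.1 b) p.2.2) ^ 2)
  have hF : 0 ≤ F := integral_nonneg fun _ => by positivity
  have hU : 0 ≤ U := integral_nonneg fun _ => by positivity
  have hA : 0 ≤ A := integral_nonneg fun _ => by positivity
  have hD : 0 ≤ D := integral_nonneg fun _ => by positivity
  simp only [← Real.sqrt_eq_rpow]
  have h1 : F ^ ((1:ℝ)/4) ≤ 4 * Real.sqrt (Real.sqrt D) * Real.sqrt (Real.sqrt A) := by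
    rw [one_div, Real.rpow_inv_le_iff_of_pos hF (by positivity) (by norm_num), Real.rpow_ofNat]
    have e : ∀ x : ℝ, 0 ≤ x → Real.sqrt (Real.sqrt x) ^ 4 = x := by
      intro x hx
      rw [show (4:ℕ) = 2 * 2 from rfl, pow_mul, Real.sq_sqrt (Real.sqrt_nonneg _), Real.sq_sqrt hx]
    rw [mul_pow, mul_pow, e D hD, e A hA]
    nlinarith [mul_nonneg hA hD]
  refine h1.trans ?_
  have := Real.sqrt_nonneg U
  gcongr <;> linarith
end
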